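/- If a totally ordered k-uplet (X₁,...,X_k) of random variables on a common finite probability space is geodesic (every totally ordered sub-triplet satisfies the triangle equality for V), then (X₁,...,X_k) form a Markov chain, and every multivariate mutual information I_m(X_{i₁};...;X_{i_m}) over a subset of the variables containing both endpoints X₁ and X_k equals I(X₁;X_k) and is therefore nonnegative. -/

import Mathlib

open Finset

structure FinProb (Ω : Type*) [Fintype Ω] where
  p : Ω → ℝ
  nonneg : ∀ ω, 0 ≤ p ω
  sum_one : ∑ ω, p ω = 1

noncomputable def pmf {Ω α : Type*} [Fintype Ω] [DecidableEq α]
    (P : FinProb Ω) (X : Ω → α) (x : α) : ℝ :=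
  ∑ ω ∈ Finset.univ.filter (fun ω => X ω = x), P.p ω

noncomputable def ent {Ω α : Type*} [Fintype Ω] [Fintype α] [DecidableEq α]
    (c : ℝ) (P : FinProb Ω) (X : Ω → α) : ℝ :=
  -∑ x : α, pmf P X x * Real.logb c (pmf P X x)

noncomputable def jent2 {Ω α β : Type*} [Fintype Ω] [Fintype α] [DecidableEq α]
    [Fintype β] [DecidableEq β] (c : ℝ) (P : FinProb Ω) (X : Ω → α) (Y : Ω → β) : ℝ :=
  ent c P (fun ω => (X ω, Y ω))

noncomputable def jent3 {Ω α β γ : Type*} [Fintype Ω] [Fintype α] [DecidableEq α]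
    [Fintype β] [DecidableEq β] [Fintype γ] [DecidableEq γ]
    (c : ℝ) (P : FinProb Ω) (X : Ω → α) (Y : Ω → β) (Z : Ω → γ) : ℝ :=
  ent c P (fun ω => (X ω, Y ω, Z ω))

noncomputable def mi {Ω α β : Type*} [Fintype Ω] [Fintype α] [DecidableEq α]
    [Fintype β] [DecidableEq β] (c : ℝ) (P : FinProb Ω) (X : Ω → α) (Y : Ω → β) : ℝ :=
  ent c P X + ent c P Y - jent2 c P X Y

noncomputable def infoDist {Ω α β : Type*} [Fintype Ω] [Fintype α] [DecidableEq α]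
    [Fintype β] [DecidableEq β] (c : ℝ) (P : FinProb Ω) (X : Ω → α) (Y : Ω → β) : ℝ :=
  jent2 c P X Y - mi c P X Y

/-- Conditional entropy `H(X|Y)`. -/
noncomputable def condEnt {Ω α β : Type*} [Fintype Ω] [Fintype α] [DecidableEq α]
    [Fintype β] [DecidableEq β] (c : ℝ) (P : FinProb Ω) (X : Ω → α) (Y : Ω → β) : ℝ :=
  jent2 c P X Y - ent c P Y

/-- Conditional mutual information `I(X;Z|Y)`. -/
noncomputable def cmi {Ω α β γ : Type*} [Fintype Ω] [Fintype α] [DecidableEq α]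
    [Fintype β] [DecidableEq β] [Fintype γ] [DecidableEq γ]
    (c : ℝ) (P : FinProb Ω) (X : Ω → α) (Z : Ω → γ) (Y : Ω → β) : ℝ :=
  jent2 c P X Y + jent2 c P Y Z - ent c P Y - jent3 c P X Y Z
/-- Joint entropy `H(X_S)` of the subfamily indexed by `S`. -/
noncomputable def entS {Ω α : Type*} [Fintype Ω] [Fintype α] [DecidableEq α] {n : ℕ}
    (c : ℝ) (P : FinProb Ω) (X : Fin n → Ω → α) (S : Finset (Fin n)) : ℝ :=
  ent c P (fun ω => (fun i : {i // i ∈ S} => X i.1 ω))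

/-- Multivariate mutual information `I_{|S|}(X_S)` via inclusion–exclusion. -/
noncomputable def miS {Ω α : Type*} [Fintype Ω] [Fintype α] [DecidableEq α] {n : ℕ}
    (c : ℝ) (P : FinProb Ω) (X : Fin n → Ω → α) (S : Finset (Fin n)) : ℝ :=
  ∑ T ∈ S.powerset.filter (fun T => T.Nonempty), (-1 : ℝ) ^ (T.card - 1) * entS c P X T

/-- `A` and `B` are conditionally independent given `C`:
`p(a,b,c) p(c) = p(a,c) p(b,c)` for all values. -/
def condIndepFun {Ω α β γ : Type*} [Fintype Ω] [DecidableEq α] [DecidableEq β] [DecidableEq γ]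
    (P : FinProb Ω) (A : Ω → α) (B : Ω → β) (C : Ω → γ) : Prop :=
  ∀ a b c0, pmf P (fun ω => (A ω, B ω, C ω)) (a, b, c0) * pmf P C c0 =
    pmf P (fun ω => (A ω, C ω)) (a, c0) * pmf P (fun ω => (B ω, C ω)) (b, c0)

/-- `(X 0, …, X (n-1))` is a Markov chain: for each `m`, the variables after `X m`
are conditionally independent of the variables before `X m`, given `X m`. -/
def isMarkov {Ω α : Type*} [Fintype Ω] [DecidableEq α] {n : ℕ}
    (P : FinProb Ω) (X : Fin n → Ω → α) : Prop :=
  ∀ m : Fin n,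
    condIndepFun P (fun ω => (fun i : {i : Fin n // i < m} => X i.1 ω))
      (fun ω => (fun i : {i : Fin n // m < i} => X i.1 ω)) (X m)

section Helpers

variable {Ω : Type*} [Fintype Ω]

lemma pmf_nonneg' {α : Type*} [DecidableEq α] (P : FinProb Ω) (X : Ω → α) (x : α) :
    0 ≤ pmf P X x := Finset.sum_nonneg (fun ω _ => P.nonneg ω)

lemma pmf_pos_self {α : Type*} [DecidableEq α] (P : FinProb Ω) (X : Ω → α) (ω : Ω)
    (h : 0 < P.p ω) : 0 < pmf P X (X ω) := by
  unfold pmf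
  exact lt_of_lt_of_le h
    (Finset.single_le_sum (f := P.p) (fun i _ => P.nonneg i) (by simp))

lemma pmf_mono' {α β : Type*} [DecidableEq α] [DecidableEq β] (P : FinProb Ω)
    (X : Ω → α) (Y : Ω → β) (x : α) (y : β) (h : ∀ ω, X ω = x → Y ω = y) :
    pmf P X x ≤ pmf P Y y := by
  unfold pmf
  apply Finset.sum_le_sum_of_subset_of_nonneg
  · intro ω hω
    simp at hω ⊢
    exact h ω hω
  · intro i _ _
    exact P.nonneg i

lemma sum_push {α : Type*} [Fintype α] [DecidableEq α] (P : FinProb Ω) (X : Ω → α)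
    (f : α → ℝ) : ∑ ω, P.p ω * f (X ω) = ∑ x, pmf P X x * f x := by
  unfold pmf
  simp_rw [Finset.sum_mul, Finset.sum_filter]
  rw [Finset.sum_comm]
  simp

lemma ent_eq {α : Type*} [Fintype α] [DecidableEq α] (c : ℝ) (P : FinProb Ω) (X : Ω → α) :
    ent c P X = -∑ ω, P.p ω * Real.logb c (pmf P X (X ω)) := by
  unfold ent
  rw [sum_push P X (fun x => Real.logb c (pmf P X x))]

lemma ent_congr {α β : Type*} [Fintype α] [DecidableEq α] [Fintype β] [DecidableEq β]
    (c : ℝ) (P : FinProb Ω) (X : Ω → α) (Y : Ω → β)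
    (h : ∀ ω ω', 0 < P.p ω → 0 < P.p ω' → (X ω = X ω' ↔ Y ω = Y ω')) :
    ent c P X = ent c P Y := by
  rw [ent_eq, ent_eq]
  congr 1
  apply Finset.sum_congr rfl
  intro ω _
  rcases (P.nonneg ω).eq_or_lt with h0 | h0
  · simp [← h0]
  · congr 2
    unfold pmf
    rw [Finset.sum_filter, Finset.sum_filter]
    apply Finset.sum_congr rfl
    intro ω' _
    rcases (P.nonneg ω').eq_or_lt with h1 | h1
    · simp [← h1]
    · have := h ω' ω h1 h0
      simp [this]

/-- finer variables have larger entropy, with equality only for a.s. determination -/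
lemma ent_mono {α β : Type*} [Fintype α] [DecidableEq α] [Fintype β] [DecidableEq β]
    (c : ℝ) (hc : 1 < c) (P : FinProb Ω) (X : Ω → α) (Y : Ω → β)
    (h : ∀ ω ω', X ω = X ω' → Y ω = Y ω') :
    ent c P Y ≤ ent c P X ∧ (ent c P X ≤ ent c P Y →
      ∀ ω ω', 0 < P.p ω → 0 < P.p ω' → Y ω = Y ω' → X ω = X ω') := by
  have key : ∀ ω, P.p ω * Real.logb c (pmf P X (X ω)) ≤
      P.p ω * Real.logb c (pmf P Y (Y ω)) := by
    intro ω
    rcases (P.nonneg ω).eq_or_lt with h0 | h0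
    · simp [← h0]
    · apply mul_le_mul_of_nonneg_left _ h0.le
      apply Real.logb_le_logb_of_le hc (pmf_pos_self P X ω h0)
      exact pmf_mono' P X Y _ _ (fun ω' e => h _ _ e)
  rw [ent_eq, ent_eq]
  refine ⟨neg_le_neg (Finset.sum_le_sum (fun ω _ => key ω)), ?_⟩
  intro hle ω ω' h0 h1 hY
  by_contra hX
  have hlt : pmf P X (X ω) < pmf P Y (Y ω) := by
    unfold pmf
    apply Finset.sum_lt_sum_of_subset (i := ω')
    · intro x hx
      simp at hx ⊢
      exact h _ _ hx
    · simp [hY]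
    · simp; exact fun e => hX e.symm
    · exact h1
    · intro j _ _
      exact P.nonneg j
  have := Finset.sum_lt_sum (s := Finset.univ) (fun ω _ => key ω)
    ⟨ω, Finset.mem_univ _, mul_lt_mul_of_pos_left
      (Real.logb_lt_logb hc (pmf_pos_self P X ω h0) hlt) h0⟩
  linarith

lemma marg {α γ : Type*} [Fintype α] [DecidableEq α] [DecidableEq γ]
    (P : FinProb Ω) (A : Ω → α) (C : Ω → γ) (z : γ) :
    ∑ a, pmf P (fun ω => (A ω, C ω)) (a, z) = pmf P C z := by
  unfold pmf
  simp_rw [Finset.sum_filter]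
  rw [Finset.sum_comm]
  apply Finset.sum_congr rfl
  intro ω _
  by_cases h : C ω = z <;> simp [h]

lemma sum_pmf {α : Type*} [Fintype α] [DecidableEq α] (P : FinProb Ω) (X : Ω → α) :
    ∑ x, pmf P X x = 1 := by
  have := sum_push P X (fun _ => 1)
  simp only [mul_one] at this
  rw [← this, P.sum_one]

lemma term_ineq (a u v w : ℝ) (ha : 0 ≤ a) (hu : 0 ≤ u) (hv : 0 ≤ v)
    (hw : 0 ≤ w) (h1 : a ≤ u) (h2 : a ≤ v) (h3 : u ≤ w) :
    a - u * v / w ≤ a * (Real.log a + Real.log w - Real.log u - Real.log v) ∧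
    (a * (Real.log a + Real.log w - Real.log u - Real.log v) ≤ a - u * v / w →
      a * w = u * v) := by
  rcases ha.eq_or_lt with h0 | h0
  · subst h0
    have : 0 ≤ u * v / w := by positivity
    refine ⟨by simpa using this, fun h => ?_⟩
    have h5 : u * v / w = 0 := by
      have : u * v / w ≤ 0 := by simpa using h
      linarith
    rcases hw.eq_or_lt with h6 | h6
    · have : u = 0 := by linarith
      simp [this]
    · have := (div_eq_zero_iff.mp h5).resolve_right h6.ne'
      linarith
  · have hu' : 0 < u := by linarith
    have hv' : 0 < v := by linarith
    have hw' : 0 < w := by linarith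
    have hr : 0 < u * v / (w * a) := by positivity
    have e : Real.log (u * v / (w * a)) =
        -(Real.log a + Real.log w - Real.log u - Real.log v) := by
      rw [Real.log_div (by positivity) (by positivity), Real.log_mul hu'.ne' hv'.ne',
        Real.log_mul hw'.ne' h0.ne']
      ring
    have e2 : u * v / w = a * (u * v / (w * a)) := by field_simp
    constructor
    · have := Real.log_le_sub_one_of_pos hr
      rw [e2]
      nlinarith
    · intro hle
      by_contra hne
      have hr1 : u * v / (w * a) ≠ 1 := by
        intro h
        rw [div_eq_one_iff_eq (by positivity)] at h
        apply hne
        linarith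
      have := Real.log_lt_sub_one_of_pos hr hr1
      rw [e2] at hle
      nlinarith

lemma gibbs {α β γ : Type*} [Fintype α] [DecidableEq α] [Fintype β] [DecidableEq β]
    [Fintype γ] [DecidableEq γ] (c : ℝ) (hc : 1 < c) (P : FinProb Ω)
    (A : Ω → α) (B : Ω → β) (C : Ω → γ) :
    ent c P C + ent c P (fun ω => (A ω, B ω, C ω)) ≤
      ent c P (fun ω => (A ω, C ω)) + ent c P (fun ω => (B ω, C ω)) ∧
    (ent c P (fun ω => (A ω, C ω)) + ent c P (fun ω => (B ω, C ω)) ≤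
      ent c P C + ent c P (fun ω => (A ω, B ω, C ω)) → condIndepFun P A B C) := by
  have hlc : 0 < Real.log c := Real.log_pos hc
  set a : α × β × γ → ℝ := pmf P (fun ω => (A ω, B ω, C ω)) with hadef
  set u : α × γ → ℝ := pmf P (fun ω => (A ω, C ω)) with hudef
  set v : β × γ → ℝ := pmf P (fun ω => (B ω, C ω)) with hvdef
  set w : γ → ℝ := pmf P C with hwdef
  set F : α × β × γ → ℝ := fun t => a t * (Real.log (a t) + Real.log (w t.2.2)
      - Real.log (u (t.1, t.2.2)) - Real.log (v (t.2.1, t.2.2))) with hF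
  set G : α × β × γ → ℝ := fun t => a t - u (t.1, t.2.2) * v (t.2.1, t.2.2) / w t.2.2 with hG
  have hsum : (ent c P (fun ω => (A ω, C ω)) + ent c P (fun ω => (B ω, C ω)) -
      (ent c P C + ent c P (fun ω => (A ω, B ω, C ω)))) * Real.log c = ∑ t, F t := by
    rw [hF, ← sum_push P (fun ω => (A ω, B ω, C ω)) (fun t => Real.log (a t) +
      Real.log (w t.2.2) - Real.log (u (t.1, t.2.2)) - Real.log (v (t.2.1, t.2.2)))]
    rw [ent_eq, ent_eq, ent_eq, ent_eq]
    simp only [Real.logb, ← mul_div_assoc, ← Finset.sum_div, mul_sub, mul_add,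
      Finset.sum_sub_distrib, Finset.sum_add_distrib]
    field_simp
    ring
  have hG0 : ∑ t, G t = 0 := by
    rw [hG, Finset.sum_sub_distrib, sum_pmf, Fintype.sum_prod_type]
    simp_rw [Fintype.sum_prod_type]
    have : ∑ x : α, ∑ y : β, ∑ z : γ, u (x, z) * v (y, z) / w z = ∑ z : γ, w z := by
      calc _ = ∑ x : α, ∑ z : γ, ∑ y : β, u (x, z) * v (y, z) / w z := by
            apply Finset.sum_congr rfl
            intro x _
            rw [Finset.sum_comm]
        _ = ∑ z : γ, ∑ x : α, ∑ y : β, u (x, z) * v (y, z) / w z := by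
            rw [Finset.sum_comm]
        _ = ∑ z : γ, (∑ x : α, u (x, z)) * (∑ y : β, v (y, z)) / w z := by
            apply Finset.sum_congr rfl
            intro z _
            rw [Finset.sum_mul_sum, Finset.sum_div]
            simp_rw [Finset.sum_div]
        _ = _ := by
            apply Finset.sum_congr rfl
            intro z _
            rw [hudef, hvdef, marg, marg, ← hwdef, mul_self_div_self]
    rw [this, hwdef, sum_pmf]
    simp
  have key : ∀ t, G t ≤ F t ∧ (F t ≤ G t →
      a t * w t.2.2 = u (t.1, t.2.2) * v (t.2.1, t.2.2)) := by
    rintro ⟨x, y, z⟩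
    apply term_ineq
    · exact pmf_nonneg' _ _ _
    · exact pmf_nonneg' _ _ _
    · exact pmf_nonneg' _ _ _
    · exact pmf_nonneg' _ _ _
    · apply pmf_mono'
      intro ω h
      simp only [Prod.mk.injEq] at h ⊢
      tauto
    · apply pmf_mono'
      intro ω h
      simp only [Prod.mk.injEq] at h ⊢
      tauto
    · apply pmf_mono'
      intro ω h
      simp only [Prod.mk.injEq] at h ⊢
      tauto
  constructor
  · have := Finset.sum_le_sum (s := Finset.univ) (fun t _ => (key t).1)
    rw [hG0, ← hsum] at this
    have := nonneg_of_mul_nonneg_left this hlc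
    linarith
  · intro hle x y z
    have h0 : ∑ t, F t ≤ ∑ t, G t := by
      rw [hG0, ← hsum]
      exact mul_nonpos_of_nonpos_of_nonneg (by linarith) hlc.le
    refine (key (x, y, z)).2 ?_
    by_contra hlt
    have := Finset.sum_lt_sum (s := Finset.univ) (fun t _ => (key t).1)
      ⟨(x, y, z), Finset.mem_univ _, not_le.mp hlt⟩
    linarith

lemma ent_const (c : ℝ) (P : FinProb Ω) : ent c P (fun _ => ()) = 0 := by
  simp [ent, pmf, P.sum_one]

lemma mi_nonneg' {α β : Type*} [Fintype α] [DecidableEq α] [Fintype β] [DecidableEq β]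
    (c : ℝ) (hc : 1 < c) (P : FinProb Ω) (A : Ω → α) (B : Ω → β) : 0 ≤ mi c P A B := by
  have h := (gibbs c hc P A B (fun _ => ())).1
  rw [ent_const, ent_congr c P (fun ω => (A ω, ())) A (by simp),
    ent_congr c P (fun ω => (B ω, ())) B (by simp),
    ent_congr c P (fun ω => (A ω, B ω, ())) (fun ω => (A ω, B ω)) (by simp)] at h
  unfold mi jent2
  linarith

/-- consequence of triangle equality for a triple -/
lemma triple {α : Type*} [Fintype α] [DecidableEq α]
    (c : ℝ) (hc : 1 < c) (P : FinProb Ω) (A M B : Ω → α)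
    (h : infoDist c P A B = infoDist c P A M + infoDist c P M B) :
    (ent c P M + ent c P (fun ω => (A ω, B ω, M ω)) =
      ent c P (fun ω => (A ω, M ω)) + ent c P (fun ω => (B ω, M ω))) ∧
    ∀ ω ω', 0 < P.p ω → 0 < P.p ω' → A ω = A ω' → B ω = B ω' → M ω = M ω' := by
  have h1 := (gibbs c hc P A B M).1
  have h2 := ent_mono c hc P (fun ω => (A ω, B ω, M ω)) (fun ω => (A ω, B ω))
    (by simp +contextual)
  have e : ent c P (fun ω => (M ω, B ω)) = ent c P (fun ω => (B ω, M ω)) :=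
    ent_congr c P _ _ (by simp [and_comm])
  unfold infoDist mi jent2 at h
  rw [e] at h
  have h3 := h2.1
  refine ⟨by linarith, fun ω ω' p p' ha hb => ?_⟩
  have := h2.2 (by linarith) ω ω' p p' (by simp [ha, hb])
  simp at this
  exact this.2.2

variable {α : Type*} [Fintype α] [DecidableEq α]

lemma fam_iff {k : ℕ} (X : Fin k → Ω → α) (T : Finset (Fin k)) (ω ω' : Ω) :
    ((fun i : {i // i ∈ T} => X i.1 ω) = (fun i : {i // i ∈ T} => X i.1 ω')) ↔
      ∀ i ∈ T, X i ω = X i ω' := by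
  simp [funext_iff]

lemma entS_single {k : ℕ} (c : ℝ) (P : FinProb Ω) (X : Fin k → Ω → α) (x : Fin k) :
    entS c P X {x} = ent c P (X x) := by
  apply ent_congr
  intro ω ω' _ _
  rw [fam_iff]; simp

lemma entS_pair {k : ℕ} (c : ℝ) (P : FinProb Ω) (X : Fin k → Ω → α) (x y : Fin k) :
    entS c P X {x, y} = ent c P (fun ω => (X x ω, X y ω)) := by
  apply ent_congr
  intro ω ω' _ _
  rw [fam_iff]; simp

lemma split {k : ℕ} (c : ℝ) (hc : 1 < c) (P : FinProb Ω) (X : Fin k → Ω → α)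
    (hgeo : ∀ h i j : Fin k, h < i → i < j →
      infoDist c P (X h) (X j) = infoDist c P (X h) (X i) + infoDist c P (X i) (X j))
    (T : Finset (Fin k)) (x : Fin k) :
    entS c P X (insert x T) + ent c P (X x) =
      entS c P X (insert x (T.filter (· < x))) + entS c P X (insert x (T.filter (x < ·))) := by
  have det : ∀ h i j : Fin k, h ≤ i → i ≤ j → ∀ ω ω', 0 < P.p ω → 0 < P.p ω' →
      X h ω = X h ω' → X j ω = X j ω' → X i ω = X i ω' := by
    intro h i j hi ij ω ω' p p' e1 e2
    rcases hi.eq_or_lt with rfl | hi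
    · exact e1
    rcases ij.eq_or_lt with rfl | ij
    · exact e2
    exact (triple c hc P _ _ _ (hgeo h i j hi ij)).2 ω ω' p p' e1 e2
  rcases (T.filter (· < x)).eq_empty_or_nonempty with hL | hL
  · have : insert x T = insert x (T.filter (x < ·)) := by
      ext i
      have : i ∉ T.filter (· < x) := by simp [hL]
      simp only [mem_filter, mem_insert] at *
      constructor
      · rintro (h | h)
        · exact Or.inl h
        · rcases lt_trichotomy i x with g | g | g <;> tauto
      · tauto
    rw [hL, this, insert_empty_eq, entS_single]
    ring
  rcases (T.filter (x < ·)).eq_empty_or_nonempty with hR | hR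
  · have : insert x T = insert x (T.filter (· < x)) := by
      ext i
      have : i ∉ T.filter (x < ·) := by simp [hR]
      simp only [mem_filter, mem_insert] at *
      constructor
      · rintro (h | h)
        · exact Or.inl h
        · rcases lt_trichotomy i x with g | g | g <;> tauto
      · tauto
    rw [hR, this, insert_empty_eq, entS_single]
  obtain ⟨a, ha, hamin⟩ := (T.filter (· < x)).exists_min_image id hL
  obtain ⟨b, hb, hbmax⟩ := (T.filter (x < ·)).exists_max_image id hR
  simp only [mem_filter, id] at ha hb hamin hbmax
  have e1 : entS c P X (insert x (T.filter (· < x))) = ent c P (fun ω => (X a ω, X x ω)) := by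
    apply ent_congr
    intro ω ω' p p'
    rw [fam_iff]
    simp only [Prod.mk.injEq, mem_insert, mem_filter]
    constructor
    · intro h
      exact ⟨h a (Or.inr ha), h x (Or.inl rfl)⟩
    · rintro ⟨g1, g2⟩ i (rfl | hi)
      · exact g2
      · exact det a i x (hamin i hi) hi.2.le ω ω' p p' g1 g2
  have e2 : entS c P X (insert x (T.filter (x < ·))) = ent c P (fun ω => (X b ω, X x ω)) := by
    apply ent_congr
    intro ω ω' p p'
    rw [fam_iff]
    simp only [Prod.mk.injEq, mem_insert, mem_filter]
    constructor
    · intro h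
      exact ⟨h b (Or.inr hb), h x (Or.inl rfl)⟩
    · rintro ⟨g1, g2⟩ i (rfl | hi)
      · exact g2
      · exact det x i b hi.2.le (hbmax i hi) ω ω' p p' g2 g1
  have e3 : entS c P X (insert x T) = ent c P (fun ω => (X a ω, X b ω, X x ω)) := by
    apply ent_congr
    intro ω ω' p p'
    rw [fam_iff]
    simp only [Prod.mk.injEq, mem_insert]
    constructor
    · intro h
      exact ⟨h a (Or.inr ha.1), h b (Or.inr hb.1), h x (Or.inl rfl)⟩
    · rintro ⟨g1, g2, g3⟩ i (rfl | hi)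
      · exact g3
      · rcases lt_trichotomy i x with g | g | g
        · exact det a i x (hamin i ⟨hi, g⟩) g.le ω ω' p p' g1 g3
        · rw [g]; exact g3
        · exact det x i b g.le (hbmax i ⟨hi, g⟩) ω ω' p p' g3 g2
  have := (triple c hc P _ _ _ (hgeo a x b ha.2 hb.2)).1
  rw [e1, e2, e3]
  linarith

lemma markov_of_geo {k : ℕ} (c : ℝ) (hc : 1 < c) (P : FinProb Ω) (X : Fin k → Ω → α)
    (hgeo : ∀ h i j : Fin k, h < i → i < j →
      infoDist c P (X h) (X j) = infoDist c P (X h) (X i) + infoDist c P (X i) (X j)) :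
    isMarkov P X := by
  intro m
  refine (gibbs c hc P _ _ _).2 ?_
  have h := split c hc P X hgeo Finset.univ m
  have e1 : entS c P X (insert m (Finset.univ.filter (· < m))) =
      ent c P (fun ω => ((fun i : {i : Fin k // i < m} => X i.1 ω), X m ω)) := by
    apply ent_congr
    intro ω ω' p p'
    rw [fam_iff]
    simp [funext_iff, and_comm]
  have e2 : entS c P X (insert m (Finset.univ.filter (m < ·))) =
      ent c P (fun ω => ((fun i : {i : Fin k // m < i} => X i.1 ω), X m ω)) := by
    apply ent_congr
    intro ω ω' p p'
    rw [fam_iff]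
    simp [funext_iff, and_comm]
  have e3 : entS c P X (insert m Finset.univ) =
      ent c P (fun ω => ((fun i : {i : Fin k // i < m} => X i.1 ω),
        (fun i : {i : Fin k // m < i} => X i.1 ω), X m ω)) := by
    apply ent_congr
    intro ω ω' p p'
    rw [fam_iff]
    simp only [Prod.mk.injEq, funext_iff, Subtype.forall]
    constructor
    · intro h
      exact ⟨fun i _ => h i (by simp), fun i _ => h i (by simp), h m (by simp)⟩
    · rintro ⟨g1, g2, g3⟩ i _
      rcases lt_trichotomy i m with g | g | g
      · exact g1 i g
      · rw [g]; exact g3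
      · exact g2 i g
  rw [e1, e2, e3] at h
  linarith

/-- alternating sums of functions not depending on membership of `e` vanish -/
lemma alt_zero {ι : Type*} [DecidableEq ι] (S : Finset ι) (e : ι) (he : e ∈ S)
    (g : Finset ι → ℝ) (hg : ∀ T, e ∉ T → g (insert e T) = g T) :
    ∑ T ∈ S.powerset, (-1 : ℝ) ^ T.card * g T = 0 := by
  obtain ⟨S', hS', rfl⟩ : ∃ S', e ∉ S' ∧ insert e S' = S :=
    ⟨S.erase e, by simp, Finset.insert_erase he⟩
  rw [Finset.sum_powerset_insert hS', ← Finset.sum_add_distrib]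
  apply Finset.sum_eq_zero
  intro T hT
  have : e ∉ T := fun h => hS' (Finset.mem_powerset.mp hT h)
  rw [hg T this, Finset.card_insert_of_notMem this]
  ring

lemma miS_eq {k : ℕ} (c : ℝ) (P : FinProb Ω) (X : Fin k → Ω → α) (S : Finset (Fin k)) :
    miS c P X S = -∑ T ∈ S.powerset, (-1 : ℝ) ^ T.card * entS c P X T := by
  unfold miS
  rw [Finset.sum_filter, ← Finset.sum_neg_distrib]
  apply Finset.sum_congr rfl
  intro T _
  split_ifs with h
  · obtain ⟨n, hn⟩ := Nat.exists_eq_succ_of_ne_zero (Finset.card_pos.mpr h).ne'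
    rw [hn]
    simp [pow_succ]
  · rw [Finset.not_nonempty_iff_eq_empty] at h
    subst h
    have : entS c P X ∅ = 0 := by
      rw [← ent_const c P]
      apply ent_congr
      intro ω ω' _ _
      rw [fam_iff]; simp
    simp [this]

lemma miS_insert {k : ℕ} (c : ℝ) (hc : 1 < c) (P : FinProb Ω) (X : Fin k → Ω → α)
    (hgeo : ∀ h i j : Fin k, h < i → i < j →
      infoDist c P (X h) (X j) = infoDist c P (X h) (X i) + infoDist c P (X i) (X j))
    (S : Finset (Fin k)) (a b x : Fin k) (ha : a ∈ S) (hb : b ∈ S) (hx : x ∉ S)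
    (hax : a < x) (hxb : x < b) : miS c P X (insert x S) = miS c P X S := by
  rw [miS_eq, miS_eq, Finset.sum_powerset_insert hx]
  have : ∑ T ∈ S.powerset, (-1 : ℝ) ^ (insert x T).card * entS c P X (insert x T) = 0 := by
    have z1 := alt_zero S b hb (fun T => entS c P X (insert x (T.filter (· < x))))
      (by intro T _; simp [Finset.filter_insert, hxb.not_gt])
    have z2 := alt_zero S a ha (fun T => entS c P X (insert x (T.filter (x < ·))))
      (by intro T _; simp [Finset.filter_insert, hax.not_gt])
    have z3 := alt_zero S a ha (fun _ => ent c P (X x)) (by simp)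
    have : ∑ T ∈ S.powerset, (-1 : ℝ) ^ (insert x T).card * entS c P X (insert x T) =
        ∑ T ∈ S.powerset, (-((-1 : ℝ) ^ T.card * entS c P X (insert x (T.filter (· < x))))
          - (-1 : ℝ) ^ T.card * entS c P X (insert x (T.filter (x < ·)))
          + (-1 : ℝ) ^ T.card * ent c P (X x)) := by
      apply Finset.sum_congr rfl
      intro T hT
      have hxT : x ∉ T := fun h => hx (Finset.mem_powerset.mp hT h)
      have h := split c hc P X hgeo T x
      rw [Finset.card_insert_of_notMem hxT, eq_sub_of_add_eq h]
      ring
    rw [this, Finset.sum_add_distrib, Finset.sum_sub_distrib, Finset.sum_neg_distrib,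
      z1, z2, z3]
    simp
  rw [this, add_zero]

lemma miS_main {k : ℕ} (c : ℝ) (hc : 1 < c) (P : FinProb Ω) (X : Fin k → Ω → α)
    (hgeo : ∀ h i j : Fin k, h < i → i < j →
      infoDist c P (X h) (X j) = infoDist c P (X h) (X i) + infoDist c P (X i) (X j))
    (a b : Fin k) (hab : a < b) (R : Finset (Fin k)) (hR : ∀ i ∈ R, a < i ∧ i < b) :
    miS c P X (R ∪ {a, b}) = mi c P (X a) (X b) := by
  induction R using Finset.induction_on with
  | empty =>
    rw [miS_eq, Finset.empty_union, Finset.sum_powerset_insert (by simp [hab.ne])]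
    have hp : ({b} : Finset (Fin k)).powerset = {∅, {b}} := by
      ext T; simp [Finset.subset_singleton_iff]
    have : entS c P X ∅ = 0 := by
      rw [← ent_const c P]
      apply ent_congr
      intro ω ω' _ _
      rw [fam_iff]; simp
    rw [hp, Finset.sum_pair (by simp [eq_comm]), Finset.sum_pair (by simp [eq_comm]),
      Finset.card_pair hab.ne, insert_empty_eq, entS_pair, entS_single, entS_single, this]
    simp [mi, jent2]
    ring
  | insert x R hx ih =>
    have h := hR x (by simp)
    rw [Finset.insert_union, miS_insert c hc P X hgeo _ a b x (by simp) (by simp)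
      (by simp [hx, h.1.ne', h.2.ne]) h.1 h.2]
    exact ih (fun i hi => hR i (by simp [hi]))

end Helpers

/-- if the totally ordered `k`-uplet `(X₁,…,X_k)` is geodesic, then it is a
Markov chain, and every multivariate mutual information over a subset of the variables
containing both endpoints equals `I(X₁;X_k)` and is therefore nonnegative. -/
theorem geodesic_kuplet_markov {Ω α : Type*} [Fintype Ω] [Fintype α] [DecidableEq α]
    {k : ℕ} (hk : 2 ≤ k) (c : ℝ) (hc : 1 < c) (P : FinProb Ω) (X : Fin k → Ω → α)
    (hgeo : ∀ h i j : Fin k, h < i → i < j →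
      infoDist c P (X h) (X j) = infoDist c P (X h) (X i) + infoDist c P (X i) (X j)) :
    isMarkov P X ∧
      ∀ S : Finset (Fin k), (⟨0, by omega⟩ : Fin k) ∈ S → (⟨k - 1, by omega⟩ : Fin k) ∈ S →
        miS c P X S = mi c P (X ⟨0, by omega⟩) (X ⟨k - 1, by omega⟩) ∧ 0 ≤ miS c P X S := by
  refine ⟨markov_of_geo c hc P X hgeo, fun S h0 h1 => ?_⟩
  have hlt : (⟨0, by omega⟩ : Fin k) < ⟨k - 1, by omega⟩ := by
    rw [Fin.mk_lt_mk]; omega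
  have hS : S = S.filter (fun i => (⟨0, by omega⟩ : Fin k) < i ∧ i < ⟨k - 1, by omega⟩) ∪
      {⟨0, by omega⟩, ⟨k - 1, by omega⟩} := by
    ext i
    simp only [mem_union, mem_filter, mem_insert, mem_singleton]
    constructor
    · intro hi
      have := i.2
      simp only [hi, Fin.lt_def, Fin.ext_iff, true_and]
      omega
    · rintro (h | rfl | rfl)
      · exact h.1
      · exact h0
      · exact h1
  have key : miS c P X S = mi c P (X ⟨0, by omega⟩) (X ⟨k - 1, by omega⟩) := by
    rw [hS]
    exact miS_main c hc P X hgeo _ _ hlt _ (fun i hi => (Finset.mem_filter.mp hi).2)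
  exact ⟨key, key ▸ mi_nonneg' c hc P _ _⟩
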